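/- Let n ≥ 1, 1 < q ≤ p < ∞ and 1 < t ≤ s < ∞ with p < s and q/p = t/s. Then every function belonging to both M^p_q(ℝ^n) and M^s_t(ℝ^n) belongs to bar-M^p_q(ℝ^n): M^p_q(ℝ^n) ∩ M^s_t(ℝ^n) ⊆ bar-M^p_q(ℝ^n). -/

import Mathlib

open MeasureTheory Metric ENNReal

noncomputable section

/-- Euclidean space ℝⁿ. -/
abbrev Eucl (n : ℕ) := EuclideanSpace ℝ (Fin n)

/-- The Morrey norm ‖f‖_{M^p_q}. -/
noncomputable def morreyNorm (n : ℕ) (p q : ℝ) (f : Eucl n → ℝ) : ℝ≥0∞ :=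
  ⨆ (x : Eucl n) (r : ℝ) (_ : 0 < r),
    (volume (ball x r)) ^ (1 / p - 1 / q) *
      (∫⁻ y in ball x r, ENNReal.ofReal (|f y| ^ q)) ^ (1 / q)

/-- Membership in the Morrey space M^p_q(ℝⁿ). -/
def MemMorrey (n : ℕ) (p q : ℝ) (f : Eucl n → ℝ) : Prop :=
  Measurable f ∧ morreyNorm n p q f < ⊤

/-- Average of `b` over the ball `B(x,r)`. -/
noncomputable def ballAvg (n : ℕ) (b : Eucl n → ℝ) (x : Eucl n) (r : ℝ) : ℝ :=
  ⨍ y in ball x r, b y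

/-- The BMO norm ‖b‖_*. -/
noncomputable def bmoNorm (n : ℕ) (b : Eucl n → ℝ) : ℝ≥0∞ :=
  ⨆ (x : Eucl n) (r : ℝ) (_ : 0 < r),
    (volume (ball x r))⁻¹ *
      ∫⁻ y in ball x r, ENNReal.ofReal |b y - ballAvg n b x r|

/-- Membership in BMO(ℝⁿ). -/
def MemBMO (n : ℕ) (b : Eucl n → ℝ) : Prop :=
  LocallyIntegrable b volume ∧ bmoNorm n b < ⊤

/-- Smooth compactly supported functions (the class C_c^∞). -/
def IsCcSmooth (n : ℕ) (φ : Eucl n → ℝ) : Prop :=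
  ContDiff ℝ (⊤ : ℕ∞) φ ∧ HasCompactSupport φ

/-- VMO(ℝⁿ): the closure of C_c^∞ in the BMO norm. -/
def MemVMO (n : ℕ) (b : Eucl n → ℝ) : Prop :=
  MemBMO n b ∧ ∀ ε : ℝ, 0 < ε → ∃ φ : Eucl n → ℝ, IsCcSmooth n φ ∧
    bmoNorm n (fun x => b x - φ x) < ENNReal.ofReal ε

/-- The tilde subspace: closure of C_c^∞ in the Morrey norm. -/
def MemTildeMorrey (n : ℕ) (p q : ℝ) (f : Eucl n → ℝ) : Prop :=
  MemMorrey n p q f ∧ ∀ ε : ℝ, 0 < ε → ∃ φ : Eucl n → ℝ, IsCcSmooth n φ ∧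
    morreyNorm n p q (fun x => f x - φ x) < ENNReal.ofReal ε

/-- The bar subspace: closure of L^∞ ∩ M^p_q in the Morrey norm. -/
def MemBarMorrey (n : ℕ) (p q : ℝ) (f : Eucl n → ℝ) : Prop :=
  MemMorrey n p q f ∧ ∀ ε : ℝ, 0 < ε → ∃ g : Eucl n → ℝ, MemMorrey n p q g ∧
    (∃ C : ℝ, ∀ᵐ x ∂(volume : Measure (Eucl n)), |g x| ≤ C) ∧
    morreyNorm n p q (fun x => f x - g x) < ENNReal.ofReal ε

/-- The star subspace: closure of the compactly supported members of M^p_q. -/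
def MemStarMorrey (n : ℕ) (p q : ℝ) (f : Eucl n → ℝ) : Prop :=
  MemMorrey n p q f ∧ ∀ ε : ℝ, 0 < ε → ∃ g : Eucl n → ℝ, MemMorrey n p q g ∧
    HasCompactSupport g ∧
    morreyNorm n p q (fun x => f x - g x) < ENNReal.ofReal ε

/-- The fractional integral operator I_α. -/
noncomputable def fracInt (n : ℕ) (α : ℝ) (f : Eucl n → ℝ) (x : Eucl n) : ℝ :=
  ∫ y, f y * dist x y ^ (α - (n : ℝ))

/-- The multilinear commutator [a_{{1,…,l}}, I_α]. -/
noncomputable def mlCommutator (n l : ℕ) (α : ℝ) (a : Fin l → Eucl n → ℝ)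
    (f : Eucl n → ℝ) (x : Eucl n) : ℝ :=
  ∫ y, (∏ j, (a j x - a j y)) * f y * dist x y ^ (α - (n : ℝ))

end

/-- A pointwise bound `|g|^q ≤ c^q |f|^t` scales to the Morrey norms when `q / p = t / s`. -/
theorem morreyNorm_le_of_rpow_le {n : ℕ} {p q s t c : ℝ} (hq : 0 < q) (ht : 0 < t) (hc : 0 ≤ c)
    (hr : q / p = t / s) {f g : Eucl n → ℝ} (h : ∀ x, |g x| ^ q ≤ c ^ q * |f x| ^ t) :
    morreyNorm n p q g ≤ ENNReal.ofReal c * morreyNorm n s t f ^ (t / q) := by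
  refine iSup_le fun x => iSup_le fun r => iSup_le fun hr0 => ?_
  have hball : volume (ball x r) ^ (1 / s - 1 / t) *
      (∫⁻ y in ball x r, ENNReal.ofReal (|f y| ^ t)) ^ (1 / t) ≤ morreyNorm n s t f :=
    le_iSup_of_le x (le_iSup_of_le r (le_iSup_of_le hr0 le_rfl))
  have hexp : (1 / s - 1 / t) * (t / q) = 1 / p - 1 / q := by
    calc (1 / s - 1 / t) * (t / q) = (t / s - t / t) / q := by ring
      _ = (q / p - q / q) / q := by rw [hr, div_self ht.ne', div_self hq.ne']
      _ = 1 / p - 1 / q := by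
        rw [sub_div, div_right_comm, div_self hq.ne']
  have hpow := ENNReal.rpow_le_rpow hball (div_nonneg ht.le hq.le)
  rw [ENNReal.mul_rpow_of_nonneg _ _ (div_nonneg ht.le hq.le), ← ENNReal.rpow_mul,
    ← ENNReal.rpow_mul, hexp, show 1 / t * (t / q) = 1 / q by field_simp] at hpow
  have hint : ∫⁻ y in ball x r, ENNReal.ofReal (|g y| ^ q) ≤
      ENNReal.ofReal c ^ q * ∫⁻ y in ball x r, ENNReal.ofReal (|f y| ^ t) := by
    rw [ENNReal.ofReal_rpow_of_nonneg hc hq.le, ← lintegral_const_mul' _ _ ofReal_ne_top]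
    refine lintegral_mono fun y => ?_
    rw [← ENNReal.ofReal_mul (by positivity)]
    exact ENNReal.ofReal_le_ofReal (h y)
  calc volume (ball x r) ^ (1 / p - 1 / q) *
        (∫⁻ y in ball x r, ENNReal.ofReal (|g y| ^ q)) ^ (1 / q)
      ≤ volume (ball x r) ^ (1 / p - 1 / q) * (ENNReal.ofReal c ^ q *
          ∫⁻ y in ball x r, ENNReal.ofReal (|f y| ^ t)) ^ (1 / q) := by gcongr
    _ = ENNReal.ofReal c * (volume (ball x r) ^ (1 / p - 1 / q) *
          (∫⁻ y in ball x r, ENNReal.ofReal (|f y| ^ t)) ^ (1 / q)) := by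
        rw [ENNReal.mul_rpow_of_nonneg _ _ (by positivity), ← ENNReal.rpow_mul,
          mul_one_div_cancel hq.ne', ENNReal.rpow_one, mul_left_comm]
    _ ≤ _ := by gcongr

/-- The Morrey norm is monotone in the absolute value of the function. -/
theorem morreyNorm_mono {n : ℕ} {p q : ℝ} (hq : 0 < q) {f g : Eucl n → ℝ}
    (h : ∀ x, |g x| ≤ |f x|) : morreyNorm n p q g ≤ morreyNorm n p q f := by
  have := morreyNorm_le_of_rpow_le (p := p) (s := p) (c := 1) hq hq zero_le_one rfl
    (f := f) (g := g) fun x => by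
      simpa using Real.rpow_le_rpow (abs_nonneg _) (h x) hq.le
  simpa [div_self hq.ne'] using this

/-- Truncating a function at a height `R` does not leave the Morrey space. -/
theorem MemMorrey.indicator_abs_le {n : ℕ} {p q : ℝ} (hq : 0 < q) {f : Eucl n → ℝ}
    (hf : MemMorrey n p q f) (R : ℝ) : MemMorrey n p q ({x | |f x| ≤ R}.indicator f) := by
  refine ⟨hf.1.indicator (measurableSet_le hf.1.abs measurable_const),
    (morreyNorm_mono hq fun x => ?_).trans_lt hf.2⟩
  by_cases hx : |f x| ≤ R <;> simp [Set.indicator, hx]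

/-- `M^p_q ∩ M^s_t ⊆ bar-M^p_q` when `p < s` and `q/p = t/s`. -/
theorem memBarMorrey_of_memMorrey_inter
    (n : ℕ) (hn : 1 ≤ n) (p q s t : ℝ)
    (hq : 1 < q) (hqp : q ≤ p) (ht : 1 < t) (hts : t ≤ s) (hps : p < s)
    (hr : q / p = t / s)
    (f : Eucl n → ℝ) (hf1 : MemMorrey n p q f) (hf2 : MemMorrey n s t f) :
    MemBarMorrey n p q f := by
  have hq0 : 0 < q := by linarith
  have ht0 : 0 < t := by linarith
  have hp0 : 0 < p := by linarith
  have hs0 : 0 < s := by linarith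
  have hqt : q < t := by
    have hmul := (div_eq_div_iff hp0.ne' hs0.ne').1 hr
    nlinarith
  refine ⟨hf1, fun ε hε => ?_⟩
  set M : ℝ := (morreyNorm n s t f ^ (t / q)).toReal
  have hM : morreyNorm n s t f ^ (t / q) = ENNReal.ofReal M :=
    (ENNReal.ofReal_toReal (ENNReal.rpow_ne_top_of_nonneg (by positivity) hf2.2.ne)).symm
  have hM0 : 0 ≤ M := ENNReal.toReal_nonneg
  set c : ℝ := ε / (M + 1)
  have hc : 0 < c := by positivity
  have hcM : c * M < ε := by
    rw [div_mul_eq_mul_div, div_lt_iff₀ (by positivity)]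
    nlinarith
  set R : ℝ := c ^ (q / (q - t))
  have hR : 0 < R := Real.rpow_pos_of_pos hc _
  have hRc : R ^ (q - t) = c ^ q := by
    rw [← Real.rpow_mul hc.le, div_mul_cancel₀ _ (by linarith)]
  refine ⟨{x | |f x| ≤ R}.indicator f, hf1.indicator_abs_le hq0 R, ⟨R, ?_⟩, ?_⟩
  · refine Filter.Eventually.of_forall fun x => ?_
    by_cases hx : |f x| ≤ R <;> simp [Set.indicator, hx, hR.le]
  · refine (morreyNorm_le_of_rpow_le (s := s) (t := t) (f := f) hq0 ht0 hc.le hr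
      fun x => ?_).trans_lt ?_
    · by_cases hx : |f x| ≤ R
      · simp only [Set.indicator, Set.mem_ofPred_eq, hx, if_true, sub_self, abs_zero,
          Real.zero_rpow hq0.ne']
        positivity
      · simp only [Set.indicator, Set.mem_ofPred_eq, hx, if_false, sub_zero]
        have hfR : R < |f x| := not_le.1 hx
        calc |f x| ^ q = |f x| ^ (q - t) * |f x| ^ t := by
              rw [← Real.rpow_add (hR.trans hfR), sub_add_cancel]
          _ ≤ R ^ (q - t) * |f x| ^ t := by
              gcongr ?_ * _
              exact Real.rpow_le_rpow_of_nonpos hR hfR.le (by linarith)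
          _ = c ^ q * |f x| ^ t := by rw [hRc]
    · rw [hM, ← ENNReal.ofReal_mul hc.le]
      exact (ENNReal.ofReal_lt_ofReal_iff hε).2 hcM
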